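/- arXiv:math/0511413 — 3 statements merged into one kernel-verified Lean document; each statement's English description precedes it below -/
import Mathlib

section
/- Let L be a finite-dimensional Lie algebra over a field k of characteristic zero. Then the Frattini subalgebra F(L) is a Lie ideal of L, and moreover F(L) is invariant under every derivation of L (it is a characteristic ideal). -/
/-- The Frattini subalgebra of a Lie algebra: the intersection of all maximal proper
Lie subalgebras (equal to all of `L` when there are no maximal subalgebras). -/
def lieFrattini (k L : Type*) [Field k] [LieRing L] [LieAlgebra k L] : LieSubalgebra k L :=
  sInf {M : LieSubalgebra k L | IsCoatom M}

open Polynomial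

theorem exists_aeval_eq_of_galois_equivariant {k K : Type*} [Field k] [Field K] [Algebra k K]
    [FiniteDimensional k K] [IsGalois k K] (S : Finset K) (hS : ∀ g : Gal(K/k), ∀ s ∈ S, g s ∈ S)
    (f : K → K) (hf : ∀ g : Gal(K/k), ∀ s ∈ S, f (g s) = g (f s)) :
    ∃ p : k[X], ∀ s ∈ S, aeval s p = f s := by
  classical
  have hinj : Set.InjOn (id : K → K) S := Function.injective_id.injOn
  set q : K[X] := Lagrange.interpolate S id f with hq
  have hfix (g : Gal(K/k)) : q.map (g : K →+* K) = q := by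
    refine Lagrange.eq_interpolate_of_eval_eq f hinj ?_ fun s hs ↦ ?_
    · exact (degree_map_le).trans_lt (Lagrange.degree_interpolate_lt f hinj)
    · have h := Lagrange.eval_interpolate_at_node f hinj (hS g⁻¹ s hs)
      rw [← hq] at h
      have h2 := hf g (g⁻¹ s) (hS g⁻¹ s hs)
      have h3 : g (g⁻¹ s) = s := g.apply_symm_apply s
      rw [h3] at h2
      simp only [id] at h ⊢
      rw [h2, ← h]
      conv_lhs => rw [← h3]
      exact eval_map_apply (g : K →+* K) (g⁻¹ s)
  have hl : q ∈ lifts (algebraMap k K) := by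
    rw [lifts_iff_coeff_lifts]
    intro n
    rw [IsGalois.mem_range_algebraMap_iff_fixed]
    intro g
    conv_rhs => rw [← hfix g]
    rw [coeff_map]; rfl
  obtain ⟨p, hp⟩ := (mem_lifts _).1 hl
  refine ⟨p, fun s hs ↦ ?_⟩
  rw [← eval_map_algebraMap, hp]
  exact Lagrange.eval_interpolate_at_node f hinj hs

theorem exists_int_valued_injOn_of_additive {K : Type*} [Field K] [CharZero K] (S : Finset K) :
    ∃ n : K → ℤ, Set.InjOn n S ∧
      ∀ a ∈ S, ∀ b ∈ S, a + b ∈ S → n (a + b) = n a + n b := by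
  classical
  obtain ⟨f, hf⟩ := Module.exists_dual_forall_apply_ne_zero (K := ℚ)
    (fun i : S.offDiag ↦ i.1.1 - i.1.2)
    (fun i ↦ sub_ne_zero.2 (Finset.mem_offDiag.1 i.2).2.2)
  obtain ⟨b, hb⟩ := IsLocalization.exist_integer_multiples_of_finset
    (nonZeroDivisors ℤ) (S.image f)
  have hb0 : (b : ℤ) ≠ 0 := nonZeroDivisors.ne_zero b.2
  have hfl : ∀ a ∈ S, ((⌊(b : ℤ) * f a⌋ : ℤ) : ℚ) = (b : ℤ) * f a := by
    intro a ha
    obtain ⟨z, hz⟩ := hb (f a) (Finset.mem_image_of_mem f ha)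
    have : ((b : ℤ) : ℚ) * f a = z := by simpa using hz.symm
    simp [this]
  refine ⟨fun a ↦ ⌊(b : ℤ) * f a⌋, fun a ha c hc h ↦ ?_, fun a ha c hc hac ↦ ?_⟩
  · by_contra hne
    have h1 : (((⌊(b : ℤ) * f a⌋ : ℤ)) : ℚ) = ((⌊(b : ℤ) * f c⌋ : ℤ) : ℚ) := congrArg _ h
    rw [hfl a ha, hfl c hc] at h1
    apply hf ⟨(a, c), Finset.mem_offDiag.2 ⟨ha, hc, hne⟩⟩
    have := mul_left_cancel₀ (Int.cast_ne_zero.2 hb0) h1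
    simp [this]
  · have : ((⌊(b : ℤ) * f (a + c)⌋ : ℤ) : ℚ) = ((⌊(b : ℤ) * f a⌋ + ⌊(b : ℤ) * f c⌋ : ℤ) : ℚ) := by
      rw [Int.cast_add, hfl _ hac, hfl a ha, hfl c hc, map_add, mul_add]
    exact_mod_cast this

theorem count_roots_prod_X_add_C_pow {ι K : Type*} [Fintype ι] [Field K] [DecidableEq K]
    (z : ι → K) (hz : Function.Injective z) (e : ι → ℕ) (i : ι) :
    (∏ j, (X + C (z j)) ^ e j : K[X]).roots.count (-z i) = e i := by
  classical
  rw [roots_prod _ _ (Finset.prod_ne_zero_iff.2 fun j _ ↦ pow_ne_zero _ (X_add_C_ne_zero _)),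
    Multiset.count_bind]
  rw [← Finset.sum_eq_multiset_sum]
  simp only [roots_pow, roots_X_add_C, Multiset.count_nsmul, Multiset.count_singleton, neg_inj,
    hz.eq_iff]
  simp

theorem exists_galois_equivariant_multiplicative_injOn {k K : Type*} [Field k] [CharZero k]
    [Field K] [Algebra k K] [FiniteDimensional k K] [IsGalois k K] (S : Finset K)
    (hS : ∀ g : Gal(K/k), ∀ s ∈ S, g s ∈ S) :
    ∃ χ : K → K, Set.InjOn χ S ∧ (∀ s, χ s ≠ 0) ∧ (∀ g : Gal(K/k), ∀ s, χ (g s) = g (χ s)) ∧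
      ∀ a ∈ S, ∀ b ∈ S, a + b ∈ S → χ (a + b) = χ a * χ b := by
  classical
  have : CharZero K := charZero_of_injective_algebraMap (algebraMap k K).injective
  obtain ⟨n, hinj, hadd⟩ := exists_int_valued_injOn_of_additive S
  obtain ⟨c, hc⟩ : ∃ c : ℕ, ∀ s ∈ S, 0 ≤ n s + c := by
    refine ⟨∑ s ∈ S, (n s).natAbs, fun s hs ↦ ?_⟩
    have := Finset.single_le_sum (f := fun s ↦ (n s).natAbs) (fun _ _ ↦ Nat.zero_le _) hs
    omega
  let pb := Field.powerBasisOfFiniteOfSeparable k K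
  set a : K := pb.gen
  have hz : Function.Injective fun g : Gal(K/k) ↦ g a := fun g h hgh ↦
    AlgEquiv.coe_toAlgHom_injective
      (pb.algHom_ext (f := (g : K →ₐ[k] K)) (g := (h : K →ₐ[k] K)) hgh)
  let P (s : K) : K[X] := ∏ g : Gal(K/k), (X + C (g a)) ^ (n (g⁻¹ s) + c).toNat
  have hP : ∀ s ∈ S, ∀ t ∈ S, s ≠ t → P s - P t ≠ 0 := by
    intro s hs t ht hst h
    have h1 (u : K) : (P u).roots.count (-a) = (n u + c).toNat := by
      exact count_roots_prod_X_add_C_pow (fun g : Gal(K/k) ↦ g a) hz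
        (fun g ↦ (n (g⁻¹ u) + c).toNat) 1
    have h2 := h1 s
    rw [sub_eq_zero.1 h, h1 t] at h2
    apply hst
    apply hinj hs ht
    have := hc s hs
    have := hc t ht
    omega
  let R : K[X] := (∏ i ∈ S.offDiag, (P i.1 - P i.2)) * ∏ g : Gal(K/k), (X + C (g a))
  have hR : R ≠ 0 := by
    refine mul_ne_zero (Finset.prod_ne_zero_iff.2 fun i hi ↦ ?_)
      (Finset.prod_ne_zero_iff.2 fun g _ ↦ X_add_C_ne_zero _)
    rw [Finset.mem_offDiag] at hi
    exact hP _ hi.1 _ hi.2.1 hi.2.2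
  obtain ⟨_, ⟨m, rfl⟩, hm⟩ := (Set.infinite_range_of_injective
    (Nat.cast_injective (R := K))).exists_notMem_finset R.roots.toFinset
  have hm : R.eval (m : K) ≠ 0 := by simpa [hR] using hm
  simp only [R, eval_mul, eval_prod, mul_ne_zero_iff, Finset.prod_ne_zero_iff] at hm
  obtain ⟨hm1, hm2⟩ := hm
  replace hm2 (g : Gal(K/k)) : (m : K) + g a ≠ 0 := by simpa using hm2 g (Finset.mem_univ _)
  let χ (s : K) : K := ∏ g : Gal(K/k), ((m : K) + g a) ^ (n (g⁻¹ s))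
  have hχ : ∀ s ∈ S, χ s * ∏ g : Gal(K/k), ((m : K) + g a) ^ c = (P s).eval (m : K) := by
    intro s hs
    simp only [χ, P, eval_prod, ← Finset.prod_mul_distrib]
    refine Finset.prod_congr rfl fun g _ ↦ ?_
    rw [← zpow_natCast, ← zpow_add₀ (hm2 g), eval_pow, eval_add, eval_X, eval_C, ← zpow_natCast,
      Int.toNat_of_nonneg (hc _ (hS g⁻¹ s hs))]
  refine ⟨χ, fun s hs t ht hst ↦ ?_, fun s ↦ ?_, fun h s ↦ ?_, fun s hs t ht hst ↦ ?_⟩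
  · by_contra hne
    refine hm1 (s, t) (Finset.mem_offDiag.2 ⟨hs, ht, hne⟩) ?_
    rw [eval_sub, ← hχ s hs, ← hχ t ht, hst, sub_self]
  · exact Finset.prod_ne_zero_iff.2 fun g _ ↦ zpow_ne_zero _ (hm2 g)
  · simp only [χ, map_prod, map_zpow₀, map_add, map_natCast]
    refine (Fintype.prod_equiv (Equiv.mulLeft h) _ _ fun g ↦ ?_).symm
    simp [← AlgEquiv.mul_apply]
  · simp only [χ, ← Finset.prod_mul_distrib]
    refine Finset.prod_congr rfl fun g _ ↦ ?_
    rw [← zpow_add₀ (hm2 g), map_add, hadd _ (hS _ _ hs) _ (hS _ _ ht)]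
    simpa using hS g⁻¹ _ hst

theorem iSup_eigenspace_eq_top_of_aeval_nodal {K V : Type*} [Field K]
    [AddCommGroup V] [Module K V] (f : Module.End K V) (S : Finset K)
    (h : aeval f (Lagrange.nodal S id) = 0) : ⨆ s ∈ S, f.eigenspace s = ⊤ := by
  classical
  rw [eq_top_iff]
  rintro x -
  rcases S.eq_empty_or_nonempty with rfl | hne
  · simp only [Lagrange.nodal_empty, map_one] at h
    have : x = 0 := LinearMap.congr_fun h x
    simp [this]
  have hx : x = ∑ s ∈ S, aeval f (Lagrange.basis S id s) x := by
    rw [← LinearMap.sum_apply, ← map_sum,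
      Lagrange.sum_basis Function.injective_id.injOn hne]
    simp
  rw [hx]
  refine Submodule.sum_mem _ fun s hs ↦ Submodule.mem_iSup_of_mem s
    (Submodule.mem_iSup_of_mem hs ?_)
  rw [Module.End.mem_eigenspace_iff, ← sub_eq_zero]
  have hb : (X - C s) * Lagrange.basis S id s
      = C (Lagrange.nodalWeight S id s) * Lagrange.nodal S id := by
    rw [Lagrange.basis_eq_prod_sub_inv_mul_nodal_div hs, Lagrange.nodal_eq_mul_nodal_erase hs, id]
    rw [mul_div_cancel_left₀ _ (X_sub_C_ne_zero s)]
    ring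
  have := LinearMap.congr_fun (congrArg (aeval f) hb) x
  rw [map_mul, map_mul, h] at this
  simpa [Module.End.mul_apply] using this

theorem lieFrattini_apply_mem {k L : Type*} [Field k] [LieRing L] [LieAlgebra k L]
    (e : L ≃ₗ⁅k⁆ L) {x : L} (hx : x ∈ lieFrattini k L) : e x ∈ lieFrattini k L := by
  let φ : LieSubalgebra k L ≃o LieSubalgebra k L :=
    { toFun := fun N ↦ N.comap e.toLieHom
      invFun := fun N ↦ N.comap e.symm.toLieHom
      left_inv := fun N ↦ by ext; simp
      right_inv := fun N ↦ by ext; simp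
      map_rel_iff' := fun {N N'} ↦
        ⟨fun h y hy ↦ by simpa using h (show e.symm y ∈ N.comap e.toLieHom by simpa using hy),
          fun h y hy ↦ h hy⟩ }
  rw [lieFrattini, ← SetLike.mem_coe, LieSubalgebra.coe_sInf, Set.mem_iInter₂] at hx ⊢
  exact fun M hM ↦ hx (φ M) ((φ.isCoatom_iff M).2 hM)

/-- The algebra of endomorphisms of a module preserving a given submodule. -/
def Submodule.endStabilizer {k V : Type*} [CommRing k] [AddCommGroup V] [Module k V]
    (F : Submodule k V) : Subalgebra k (Module.End k V) where
  carrier := {f | ∀ x ∈ F, f x ∈ F}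
  mul_mem' := fun hf hg x hx ↦ hf _ (hg x hx)
  add_mem' := fun hf hg x hx ↦ F.add_mem (hf x hx) (hg x hx)
  algebraMap_mem' := fun r _ hx ↦ F.smul_mem r hx

theorem IsNilpotent.mem_subalgebra_of_exp_mem {k E : Type*} [Field k] [CharZero k] [Ring E]
    [Algebra k E] [Module ℚ E] (A : Subalgebra k E) {a : E} (ha : IsNilpotent a)
    (hA : IsNilpotent.exp a ∈ A) : a ∈ A := by
  obtain ⟨d, hd⟩ := ha
  let r : k[X] := ∑ i ∈ Finset.range d, C (((i + 2).factorial : k)⁻¹) * X ^ i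
  have hr : IsNilpotent.exp a = aeval a (X + X ^ 2 * r) + 1 := by
    have hd' : a ^ (d + 2) = 0 := by rw [pow_add, hd, zero_mul]
    rw [IsNilpotent.exp_eq_sum hd', Finset.sum_range_succ', Finset.sum_range_succ']
    simp only [r, Finset.mul_sum, map_add, map_sum, map_mul, aeval_X, aeval_X_pow, aeval_C]
    rw [add_comm (a : E)]
    congr 2
    · refine Finset.sum_congr rfl fun i _ ↦ ?_
      rw [← Rat.cast_smul_eq_qsmul k, Algebra.smul_def, Algebra.left_comm, ← pow_add]
      simp [add_comm, add_left_comm, one_add_one_eq_two]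
    · simp
    · simp
  have key : ∀ j i : ℕ, 1 ≤ i → d ≤ i + j → ∀ q : k[X], aeval a (X ^ i * q) ∈ A := by
    intro j
    induction j with
    | zero =>
      intro i _ hi q
      rw [map_mul, aeval_X_pow, pow_eq_zero_of_le (by omega : d ≤ i) hd, zero_mul]
      exact A.zero_mem
    | succ j ih =>
      intro i hi hij q
      have hdvd : X ∣ 1 - (1 + X * r) ^ i := by
        rw [X_dvd_iff]
        simp [coeff_zero_eq_eval_zero]
      obtain ⟨s, hs⟩ := hdvd
      have h1 : X ^ i * q = C (q.coeff 0) * (X + X ^ 2 * r) ^ i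
          + X ^ (i + 1) * (q.divX + C (q.coeff 0) * s) := by
        have h2 : (X + X ^ 2 * r) ^ i = X ^ i * (1 - X * s) := by
          rw [← hs, sub_sub_cancel, ← mul_pow]
          congr 1
          ring
        rw [h2]
        conv_lhs => rw [← divX_mul_X_add q]
        ring
      rw [h1, map_add, map_mul, aeval_C, map_pow]
      have h3 : aeval a (X + X ^ 2 * r) ∈ A := by
        rw [← sub_eq_iff_eq_add.2 hr]
        exact A.sub_mem hA A.one_mem
      exact A.add_mem (A.mul_mem (A.algebraMap_mem _) (A.pow_mem h3 i))
        (ih (i + 1) (by omega) (by omega) _)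
  simpa using key d 1 le_rfl (by omega) 1

theorem LieDerivation.apply_mem_of_isNilpotent {k L : Type*} [Field k] [CharZero k] [LieRing L]
    [LieAlgebra k L] (F : Submodule k L) (hF : ∀ e : L ≃ₗ⁅k⁆ L, ∀ x ∈ F, e x ∈ F)
    (D : LieDerivation k L L) (hD : IsNilpotent D.toLinearMap) {x : L} (hx : x ∈ F) :
    D x ∈ F := by
  let : Module ℚ L := Module.compHom L (algebraMap ℚ k)
  let : LieAlgebra ℚ L := { lie_smul := fun t x y ↦ lie_smul (algebraMap ℚ k t) x y }
  exact IsNilpotent.mem_subalgebra_of_exp_mem F.endStabilizer hD (hF (D.exp hD)) x hx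

section BaseChange

open TensorProduct

theorem LinearMap.ext_of_iSup_eq_top {K V W : Type*} [Field K] [AddCommGroup V] [Module K V]
    [AddCommGroup W] [Module K W] {p : K → Submodule K V} {S : Finset K}
    (h : ⨆ s ∈ S, p s = ⊤) {f g : V →ₗ[K] W} (hfg : ∀ s ∈ S, ∀ x ∈ p s, f x = g x) : f = g := by
  have : (⨆ s ∈ S, p s) ≤ LinearMap.eqLocus f g := iSup₂_le hfg
  exact LinearMap.ext fun x ↦ this (h ▸ Submodule.mem_top)

theorem LinearMap.ext₂_of_iSup_eq_top {K V W : Type*} [Field K] [AddCommGroup V] [Module K V]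
    [AddCommGroup W] [Module K W] {p : K → Submodule K V} {S : Finset K}
    (h : ⨆ s ∈ S, p s = ⊤) {f g : V →ₗ[K] V →ₗ[K] W}
    (hfg : ∀ s ∈ S, ∀ t ∈ S, ∀ x ∈ p s, ∀ y ∈ p t, f x y = g x y) : f = g :=
  ext_of_iSup_eq_top h fun s hs x hx ↦ ext_of_iSup_eq_top h fun t ht y hy ↦ hfg s hs t ht x hx y hy

theorem Module.End.aeval_baseChange {k : Type*} (K : Type*) {V : Type*} [Field k] [Field K]
    [Algebra k K] [AddCommGroup V] [Module k V] (f : Module.End k V) (p : k[X]) :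
    aeval (f.baseChange K) (p.map (algebraMap k K)) = (aeval f p).baseChange K := by
  rw [aeval_map_algebraMap]
  exact aeval_algHom_apply (Module.End.baseChangeHom k K V) f p

theorem LinearMap.baseChange_leibniz {k : Type*} (K : Type*) {L : Type*} [Field k] [Field K]
    [Algebra k K] [LieRing L] [LieAlgebra k L] (D : LieDerivation k L L) (x y : K ⊗[k] L) :
    D.toLinearMap.baseChange K ⁅x, y⁆ =
      ⁅D.toLinearMap.baseChange K x, y⁆ + ⁅x, D.toLinearMap.baseChange K y⁆ := by
  rw [add_comm]
  exact (Lie.Derivation.ofLieDerivation K D).apply_lie_eq_add x y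

variable {k K L : Type*} [Field k] [Field K] [Algebra k K] [LieRing L] [LieAlgebra k L]

theorem one_tmul_injective {x y : L} (h : (1 : K) ⊗ₜ[k] x = 1 ⊗ₜ y) : x = y :=
  Module.FaithfullyFlat.tensorProduct_mk_injective (A := k) (B := K) L h

theorem iSup_eigenspace_baseChange {V : Type*} [AddCommGroup V] [Module k V] [FiniteDimensional k V]
    (T : Module.End k V) (hsep : (minpoly k T).Separable)
    (hsplit : ((minpoly k T).map (algebraMap k K)).Splits) (S : Finset K)
    (hS : ∀ s, s ∈ S ↔ aeval s (minpoly k T) = 0) :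
    ⨆ s ∈ S, Module.End.eigenspace (T.baseChange K) s = ⊤ := by
  classical
  apply iSup_eigenspace_eq_top_of_aeval_nodal
  have hm : (minpoly k T).Monic := minpoly.monic (Algebra.IsIntegral.isIntegral T)
  have h0 : (minpoly k T).map (algebraMap k K) ≠ 0 := (hm.map _).ne_zero
  have hSv : S.val = ((minpoly k T).map (algebraMap k K)).roots := by
    refine (Multiset.Nodup.ext S.nodup (nodup_roots hsep.map)).2 fun s ↦ ?_
    rw [Finset.mem_val, hS, mem_roots h0, IsRoot, eval_map_algebraMap]
  have : Lagrange.nodal S id = (minpoly k T).map (algebraMap k K) := by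
    conv_rhs => rw [hsplit.eq_prod_roots_of_monic (hm.map _), ← hSv]
    rfl
  rw [this, Module.End.aeval_baseChange, minpoly.aeval, LinearMap.baseChange_zero]

theorem eq_zero_of_baseChange_eq_zero {f : Module.End k L} (h : f.baseChange K = 0) : f = 0 := by
  ext x
  refine one_tmul_injective (k := k) (K := K) ?_
  have := LinearMap.congr_fun h (1 ⊗ₜ x)
  rwa [LinearMap.baseChange_tmul, LinearMap.zero_apply, ← tmul_zero L (1 : K)] at this

theorem aeval_baseChange_apply {T : Module.End k L} {s : K} {x : K ⊗[k] L}
    (hx : x ∈ Module.End.eigenspace (T.baseChange K) s) (p : k[X]) :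
    (aeval T p).baseChange K x = aeval s p • x := by
  rw [← Module.End.aeval_baseChange, Module.End.aeval_apply_of_mem_apply_eq_smul
    (Module.End.mem_eigenspace_iff.1 hx),
    eval_map_algebraMap]

theorem lie_mem_maxGenEigenspace_of_leibniz {A : Type*} [LieRing A] [LieAlgebra K A]
    (D : Module.End K A) (hD : ∀ x y, D ⁅x, y⁆ = ⁅D x, y⁆ + ⁅x, D y⁆) {s t : K} {x y : A}
    (hx : x ∈ D.maxGenEigenspace s) (hy : y ∈ D.maxGenEigenspace t) :
    ⁅x, y⁆ ∈ D.maxGenEigenspace (s + t) := by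
  rw [Module.End.mem_maxGenEigenspace] at hx hy ⊢
  obtain ⟨i, hi⟩ := hx
  obtain ⟨j, hj⟩ := hy
  have key : ∀ n i j : ℕ, i + j ≤ n → ∀ x y : A, ((D - s • 1) ^ i) x = 0 →
      ((D - t • 1) ^ j) y = 0 → ((D - (s + t) • 1) ^ n) ⁅x, y⁆ = 0 := by
    intro n
    induction n with
    | zero =>
      intro i j hij x y hx hy
      obtain rfl : i = 0 := by omega
      have : x = 0 := hx
      simp [this]
    | succ n ih =>
      intro i j hij x y hx hy
      rcases i with _ | i
      · have : x = 0 := hx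
        simp [this]
      rcases j with _ | j
      · have : y = 0 := hy
        simp [this]
      have h1 : (D - (s + t) • 1) ⁅x, y⁆ = ⁅(D - s • 1) x, y⁆ + ⁅x, (D - t • 1) y⁆ := by
        simp only [LinearMap.sub_apply, hD, LinearMap.smul_apply, Module.End.one_apply, sub_lie,
          lie_sub, smul_lie, lie_smul, add_smul, LinearMap.add_apply]
        abel
      rw [pow_succ, Module.End.mul_apply, h1, map_add,
        ih i (j + 1) (by omega) _ _ (by rwa [pow_succ] at hx) hy,
        ih (i + 1) j (by omega) _ _ hx (by rwa [pow_succ] at hy), add_zero]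
  exact ⟨i + j, key _ i j le_rfl x y hi hj⟩

theorem lie_mem_eigenspace_of_leibniz_add {A : Type*} [LieRing A] [LieAlgebra K A]
    {N T : Module.End K A} (hc : Commute N T) (hN : IsNilpotent N) (hT : T.IsFinitelySemisimple)
    (hD : ∀ x y, (N + T) ⁅x, y⁆ = ⁅(N + T) x, y⁆ + ⁅x, (N + T) y⁆) {s t : K} {x y : A}
    (hx : x ∈ T.eigenspace s) (hy : y ∈ T.eigenspace t) : ⁅x, y⁆ ∈ T.eigenspace (s + t) := by
  have hle (u : K) : T.eigenspace u ≤ (N + T).maxGenEigenspace u := by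
    obtain ⟨n, hn⟩ := hN
    have key : ∀ m : ℕ, ∀ z ∈ T.eigenspace u, ((N + T - u • 1) ^ m) z = (N ^ m) z := by
      intro m
      induction m with
      | zero => simp
      | succ m ih =>
        intro z hz
        have h1 : (N + T - u • 1) z = N z := by
          simp [Module.End.mem_eigenspace_iff.1 hz]
        have h2 : N z ∈ T.eigenspace u :=
          Module.End.mapsTo_genEigenspace_of_comm hc.symm u 1 hz
        rw [pow_succ, pow_succ, Module.End.mul_apply, Module.End.mul_apply, h1, ih _ h2]
    intro z hz
    exact Module.End.mem_maxGenEigenspace _ _ _ |>.2 ⟨n, by rw [key n z hz, hn]; rfl⟩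
  rw [Module.End.mem_eigenspace_iff]
  exact Module.End.apply_eq_of_mem_of_comm_of_isFinitelySemisimple_of_isNil
    (lie_mem_maxGenEigenspace_of_leibniz (N + T) hD (hle s hx) (hle t hy))
    (hc.add_left rfl) hT (by simpa using hN)

theorem leibniz_of_lie_mem_eigenspace {T : Module.End k L} {S : Finset K}
    (htop : ⨆ s ∈ S, Module.End.eigenspace (T.baseChange K) s = ⊤)
    (hlie : ∀ s t, ∀ x ∈ Module.End.eigenspace (T.baseChange K) s,
      ∀ y ∈ Module.End.eigenspace (T.baseChange K) t,
      ⁅x, y⁆ ∈ Module.End.eigenspace (T.baseChange K) (s + t)) (x y : L) :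
    T ⁅x, y⁆ = ⁅T x, y⁆ + ⁅x, T y⁆ := by
  let br : K ⊗[k] L →ₗ[K] K ⊗[k] L →ₗ[K] K ⊗[k] L := LieModule.toEnd K (K ⊗[k] L) (K ⊗[k] L)
  have h : br.compr₂ (T.baseChange K) = br.comp (T.baseChange K) + br.compl₂ (T.baseChange K) := by
    refine LinearMap.ext₂_of_iSup_eq_top htop fun s _ t _ x hx y hy ↦ ?_
    have h := Module.End.mem_eigenspace_iff.1 (hlie s t x hx y hy)
    rw [Module.End.mem_eigenspace_iff] at hx hy
    change T.baseChange K ⁅x, y⁆ = ⁅T.baseChange K x, y⁆ + ⁅x, T.baseChange K y⁆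
    rw [h, hx, hy, smul_lie, lie_smul, add_smul]
  have h1 := LinearMap.congr_fun₂ h (1 ⊗ₜ x) (1 ⊗ₜ y)
  change T.baseChange K ⁅(1 : K) ⊗ₜ[k] x, (1 : K) ⊗ₜ[k] y⁆ =
    ⁅T.baseChange K (1 ⊗ₜ x), (1 : K) ⊗ₜ[k] y⁆ + ⁅(1 : K) ⊗ₜ[k] x, T.baseChange K (1 ⊗ₜ y)⁆ at h1
  simp only [LieAlgebra.ExtendScalars.bracket_tmul, LinearMap.baseChange_tmul, mul_one,
    ← tmul_add] at h1
  exact one_tmul_injective h1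

theorem aeval_lie_of_multiplicative {T : Module.End k L} {S : Finset K}
    (htop : ⨆ s ∈ S, Module.End.eigenspace (T.baseChange K) s = ⊤)
    (hbot : ∀ s ∉ S, Module.End.eigenspace (T.baseChange K) s = ⊥)
    (hlie : ∀ s t, ∀ x ∈ Module.End.eigenspace (T.baseChange K) s,
      ∀ y ∈ Module.End.eigenspace (T.baseChange K) t,
      ⁅x, y⁆ ∈ Module.End.eigenspace (T.baseChange K) (s + t)) (p : k[X])
    (hp : ∀ s ∈ S, ∀ t ∈ S, s + t ∈ S → aeval (s + t) p = aeval s p * aeval t p) (x y : L) :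
    aeval T p ⁅x, y⁆ = ⁅aeval T p x, aeval T p y⁆ := by
  let br : K ⊗[k] L →ₗ[K] K ⊗[k] L →ₗ[K] K ⊗[k] L := LieModule.toEnd K (K ⊗[k] L) (K ⊗[k] L)
  have h : br.compr₂ ((aeval T p).baseChange K) =
      br.compl₁₂ ((aeval T p).baseChange K) ((aeval T p).baseChange K) := by
    refine LinearMap.ext₂_of_iSup_eq_top htop fun s hs t ht x hx y hy ↦ ?_
    have h := hlie s t x hx y hy
    change (aeval T p).baseChange K ⁅x, y⁆ =
      ⁅(aeval T p).baseChange K x, (aeval T p).baseChange K y⁆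
    rw [aeval_baseChange_apply hx, aeval_baseChange_apply hy, aeval_baseChange_apply h, smul_lie,
      lie_smul, smul_smul]
    by_cases hst : s + t ∈ S
    · rw [hp s hs t ht hst]
    · rw [hbot _ hst, Submodule.mem_bot] at h
      rw [h, smul_zero, smul_zero]
  have h1 := LinearMap.congr_fun₂ h (1 ⊗ₜ x) (1 ⊗ₜ y)
  change (aeval T p).baseChange K ⁅(1 : K) ⊗ₜ[k] x, (1 : K) ⊗ₜ[k] y⁆ =
    ⁅(aeval T p).baseChange K (1 ⊗ₜ x), (aeval T p).baseChange K (1 ⊗ₜ y)⁆ at h1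
  simp only [LieAlgebra.ExtendScalars.bracket_tmul, LinearMap.baseChange_tmul, mul_one] at h1
  exact one_tmul_injective h1

theorem aeval_eq_zero_of_forall_eigenvalue {T : Module.End k L} {S : Finset K}
    (htop : ⨆ s ∈ S, Module.End.eigenspace (T.baseChange K) s = ⊤) {p : k[X]}
    (hp : ∀ s ∈ S, aeval s p = 0) : aeval T p = 0 := by
  refine eq_zero_of_baseChange_eq_zero (K := K)
    (LinearMap.ext_of_iSup_eq_top htop fun s hs x hx ↦ ?_)
  rw [aeval_baseChange_apply hx, hp s hs, zero_smul, LinearMap.zero_apply]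

theorem apply_mem_of_lie_mem_eigenspace [CharZero k] [FiniteDimensional k K] [IsGalois k K]
    {T : Module.End k L} {S : Finset K} (hS : ∀ g : Gal(K/k), ∀ s ∈ S, g s ∈ S)
    (htop : ⨆ s ∈ S, Module.End.eigenspace (T.baseChange K) s = ⊤)
    (hbot : ∀ s ∉ S, Module.End.eigenspace (T.baseChange K) s = ⊥)
    (hlie : ∀ s t, ∀ x ∈ Module.End.eigenspace (T.baseChange K) s,
      ∀ y ∈ Module.End.eigenspace (T.baseChange K) t,
      ⁅x, y⁆ ∈ Module.End.eigenspace (T.baseChange K) (s + t))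
    (F : Submodule k L) (hF : ∀ e : L ≃ₗ⁅k⁆ L, ∀ x ∈ F, e x ∈ F) {x : L} (hx : x ∈ F) :
    T x ∈ F := by
  classical
  obtain ⟨χ, hinj, hne, hgal, hmul⟩ := exists_galois_equivariant_multiplicative_injOn S hS
  obtain ⟨p, hp⟩ := exists_aeval_eq_of_galois_equivariant S hS χ fun g s _ ↦ hgal g s
  obtain ⟨p', hp'⟩ := exists_aeval_eq_of_galois_equivariant S hS (fun s ↦ (χ s)⁻¹)
    fun g s _ ↦ by simp [hgal g s]
  obtain ⟨q, hq⟩ := exists_aeval_eq_of_galois_equivariant (S.image χ)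
    (fun g t ht ↦ by
      obtain ⟨s, hs, rfl⟩ := Finset.mem_image.1 ht
      exact Finset.mem_image.2 ⟨g s, hS g s hs, hgal g s⟩)
    (Function.invFunOn χ S) (fun g t ht ↦ by
      obtain ⟨s, hs, rfl⟩ := Finset.mem_image.1 ht
      rw [← hgal, hinj.leftInvOn_invFunOn hs, hinj.leftInvOn_invFunOn (hS g s hs)])
  have h1 : aeval T p * aeval T p' = 1 := by
    rw [← sub_eq_zero, ← map_mul, ← map_one (aeval (R := k) T), ← map_sub]
    refine aeval_eq_zero_of_forall_eigenvalue htop fun s hs ↦ ?_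
    rw [map_sub, map_mul, hp s hs, hp' s hs, mul_inv_cancel₀ (hne s), map_one, sub_self]
  have h2 : aeval T p' * aeval T p = 1 := by rw [← map_mul, mul_comm, map_mul, h1]
  have h3 : aeval (aeval T p) q = T := by
    have h := aeval_eq_zero_of_forall_eigenvalue (p := q.comp p - X) htop fun s hs ↦ by
      rw [map_sub, aeval_comp, hp s hs, hq _ (Finset.mem_image_of_mem χ hs), aeval_X,
        hinj.leftInvOn_invFunOn hs, sub_self]
    rwa [map_sub, aeval_comp, aeval_X, sub_eq_zero] at h
  let e : L ≃ₗ⁅k⁆ L :=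
    { toLinearMap := aeval T p
      map_lie' := fun {x y} ↦ aeval_lie_of_multiplicative htop hbot hlie p
        (fun s hs t ht hst ↦ by rw [hp s hs, hp t ht, hp _ hst, hmul s hs t ht hst]) x y
      invFun := aeval T p'
      left_inv := LinearMap.congr_fun h2
      right_inv := LinearMap.congr_fun h1 }
  have h4 : aeval T p ∈ F.endStabilizer := hF e
  have h5 : T ∈ F.endStabilizer := by
    rw [← h3]
    exact Algebra.adjoin_le (Set.singleton_subset_iff.2 h4) (aeval_mem_adjoin_singleton k _)
  exact h5 x hx

end BaseChange

theorem LieDerivation.apply_mem_of_forall_lieEquiv {k L : Type*} [Field k] [CharZero k]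
    [LieRing L] [LieAlgebra k L] [FiniteDimensional k L] (F : Submodule k L)
    (hF : ∀ e : L ≃ₗ⁅k⁆ L, ∀ x ∈ F, e x ∈ F) (D : LieDerivation k L L) {x : L} (hx : x ∈ F) :
    D x ∈ F := by
  classical
  obtain ⟨N, hNmem, T, hTmem, hN, hT, hD⟩ :=
    Module.End.exists_isNilpotent_isSemisimple (f := D.toLinearMap)
  have hc : Commute N T := Algebra.commute_of_mem_adjoin_singleton_of_commute hTmem
    (Algebra.commute_of_mem_adjoin_self hNmem).symm
  let m := minpoly k T
  let K := m.SplittingField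
  have hm : m ≠ 0 := minpoly.ne_zero (Algebra.IsIntegral.isIntegral T)
  have hsep : m.Separable := PerfectField.separable_iff_squarefree.2 hT.minpoly_squarefree
  have : IsGalois k K := IsGalois.of_separable_splitting_field (p := m) hsep
  let S : Finset K := (m.aroots K).toFinset
  have hS (s : K) : s ∈ S ↔ aeval s m = 0 := by simp [S, hm]
  have htop := iSup_eigenspace_baseChange T hsep (SplittingField.splits m) S hS
  have hbot : ∀ s ∉ S, Module.End.eigenspace (T.baseChange K) s = ⊥ := by
    refine fun s hs ↦ (Submodule.eq_bot_iff _).2 fun x hx ↦ ?_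
    have h := aeval_baseChange_apply hx m
    rw [minpoly.aeval, LinearMap.baseChange_zero, LinearMap.zero_apply] at h
    exact (smul_eq_zero.1 h.symm).resolve_left (mt (hS s).2 hs)
  have hTK : Module.End.IsSemisimple (T.baseChange K) := by
    refine Module.End.isSemisimple_of_squarefree_aeval_eq_zero
      (hsep.map (f := algebraMap k K)).squarefree ?_
    rw [Module.End.aeval_baseChange, minpoly.aeval, LinearMap.baseChange_zero]
  have hNK : IsNilpotent (N.baseChange K) := hN.map (Module.End.baseChangeHom k K L)
  have hcK : Commute (N.baseChange K) (T.baseChange K) := hc.map (Module.End.baseChangeHom k K L)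
  have hlie (s t : K) (x) (hx : x ∈ Module.End.eigenspace (T.baseChange K) s) (y)
      (hy : y ∈ Module.End.eigenspace (T.baseChange K) t) :
      ⁅x, y⁆ ∈ Module.End.eigenspace (T.baseChange K) (s + t) := by
    refine lie_mem_eigenspace_of_leibniz_add hcK hNK hTK.isFinitelySemisimple ?_ hx hy
    rw [← LinearMap.baseChange_add, ← hD]
    exact LinearMap.baseChange_leibniz K D
  let DN : LieDerivation k L L :=
    { toLinearMap := N
      leibniz' := fun a b ↦ by
        have h1 : N = D.toLinearMap - T := eq_sub_of_add_eq hD.symm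
        have h2 := leibniz_of_lie_mem_eigenspace htop hlie a b
        have h3 : D ⁅a, b⁆ = ⁅a, D b⁆ + ⁅D a, b⁆ := D.apply_lie_eq_add a b
        rw [← lie_skew b (N a), h1]
        simp only [LinearMap.sub_apply, LieDerivation.coeFn_coe, h2, h3, lie_sub, sub_lie]
        abel }
  have hTx : T x ∈ F := apply_mem_of_lie_mem_eigenspace
    (fun g s hs ↦ by rw [hS] at hs ⊢; exact (aeval_algHom_apply g s m).trans (by rw [hs, map_zero]))
    htop hbot hlie F hF hx
  have hNx : N x ∈ F := DN.apply_mem_of_isNilpotent F hF hN hx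
  have : D x = N x + T x := LinearMap.congr_fun hD x
  rw [this]
  exact F.add_mem hNx hTx

/-- the Frattini subalgebra of a finite-dimensional Lie algebra over a field of
characteristic zero is an ideal, invariant under every derivation. -/
theorem stmt1 (k L : Type*) [Field k] [CharZero k] [LieRing L] [LieAlgebra k L]
    [FiniteDimensional k L] :
    (∀ x ∈ lieFrattini k L, ∀ y : L, ⁅y, x⁆ ∈ lieFrattini k L) ∧
    (∀ D : LieDerivation k L L, ∀ x ∈ lieFrattini k L, D x ∈ lieFrattini k L) := by
  have h (D : LieDerivation k L L) (x : L) (hx : x ∈ lieFrattini k L) : D x ∈ lieFrattini k L :=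
    D.apply_mem_of_forall_lieEquiv (lieFrattini k L).toSubmodule
      (fun e _ ↦ lieFrattini_apply_mem e) hx
  exact ⟨fun x hx y ↦ by simpa using h (LieDerivation.ad k L y) x hx, h⟩
end

section
/- Let L be a finite-dimensional elementary Lie algebra over a field k. Then for every Lie ideal B of L there exists a Lie subalgebra C of L such that B ∩ C = 0 and B + C = L, i.e., L is the internal direct sum of B and C. -/
/-- A Lie algebra is elementary if every Lie subalgebra has trivial Frattini subalgebra. -/
def IsElementaryLieAlgebra (k L : Type*) [Field k] [LieRing L] [LieAlgebra k L] : Prop :=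
  ∀ C : LieSubalgebra k L, lieFrattini k C = ⊥

/-- The sum of a Lie subalgebra and a Lie ideal, as a Lie subalgebra. -/
def LieSubalgebra.supIdeal {k L : Type*} [Field k] [LieRing L] [LieAlgebra k L]
    (M : LieSubalgebra k L) (I : LieIdeal k L) : LieSubalgebra k L where
  __ := M.toSubmodule ⊔ I.toSubmodule
  lie_mem' := by
    intro x y hx hy
    obtain ⟨m, hm, a, ha, rfl⟩ := Submodule.mem_sup.mp hx
    obtain ⟨n, hn, b, hb, rfl⟩ := Submodule.mem_sup.mp hy
    refine Submodule.mem_sup.mpr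
      ⟨⁅m, n⁆, M.lie_mem hm hn, ⁅m, b⁆ + ⁅a, n + b⁆, ?_, ?_⟩
    · exact add_mem (lie_mem_right k L I m b hb) (lie_mem_left k L I a (n + b) ha)
    · rw [add_lie, lie_add m n b, add_assoc]

/-- An ideal not contained in the Frattini subalgebra is supplemented by a maximal subalgebra. -/
theorem exists_isCoatom_sup_eq_top {k L : Type*} [Field k] [LieRing L] [LieAlgebra k L]
    {I : LieIdeal k L} (hI : ¬ I.toSubmodule ≤ (lieFrattini k L).toSubmodule) :
    ∃ M : LieSubalgebra k L, IsCoatom M ∧ M.toSubmodule ⊔ I.toSubmodule = ⊤ := by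
  obtain ⟨x, hxI, hx⟩ := Set.not_subset.mp hI
  obtain ⟨M, hM, hxM⟩ : ∃ M : LieSubalgebra k L, IsCoatom M ∧ x ∉ M := by
    by_contra! h
    refine hx (show x ∈ ((lieFrattini k L : LieSubalgebra k L) : Set L) from ?_)
    rw [lieFrattini, LieSubalgebra.coe_sInf]
    exact Set.mem_iInter₂.mpr h
  have hlt : M < M.supIdeal I := by
    refine lt_of_le_of_ne (fun y hy ↦ Submodule.mem_sup_left hy) fun h ↦ hxM ?_
    rw [h]
    exact Submodule.mem_sup_right hxI
  exact ⟨M, hM, congrArg LieSubalgebra.toSubmodule (hM.2 _ hlt)⟩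

/-- in an elementary Lie algebra every ideal has a complementary subalgebra. -/
theorem stmt11 (k L : Type*) [Field k] [LieRing L] [LieAlgebra k L]
    [FiniteDimensional k L] (hL : IsElementaryLieAlgebra k L) (B : LieIdeal k L) :
    ∃ C : LieSubalgebra k L,
      B.toSubmodule ⊓ C.toSubmodule = ⊥ ∧ B.toSubmodule ⊔ C.toSubmodule = ⊤ := by
  obtain ⟨C, hC, hmin⟩ := (InvImage.wf LieSubalgebra.toSubmodule
    (wellFounded_lt (α := Submodule k L))).has_min
    {C : LieSubalgebra k L | B.toSubmodule ⊔ C.toSubmodule = ⊤} ⟨⊤, by simp⟩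
  refine ⟨C, ?_, hC⟩
  by_contra hne
  have hI : ¬ (B.comap C.incl).toSubmodule ≤ (lieFrattini k C).toSubmodule := by
    rw [hL C]
    refine fun h ↦ hne ((Submodule.eq_bot_iff _).mpr fun x hx ↦ ?_)
    have hx0 : (⟨x, hx.2⟩ : C) ∈ (⊥ : LieSubalgebra k C) :=
      h (show (⟨x, hx.2⟩ : C) ∈ B.comap C.incl from LieIdeal.mem_comap.mpr hx.1)
    exact congrArg Subtype.val ((LieSubalgebra.mem_bot _).mp hx0)
  obtain ⟨M, hM, hsup⟩ := exists_isCoatom_sup_eq_top hI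
  refine hmin (M.map C.incl) ?_ ?_
  · refine eq_top_iff.mpr (hC.symm.le.trans (sup_le le_sup_left fun x hx ↦ ?_))
    have hxs : (⟨x, hx⟩ : C) ∈ M.toSubmodule ⊔ (B.comap C.incl).toSubmodule :=
      hsup ▸ Submodule.mem_top
    obtain ⟨m, hm, b, hb, hmb⟩ := Submodule.mem_sup.mp hxs
    refine Submodule.mem_sup.mpr ⟨b, LieIdeal.mem_comap.mp hb, m, ⟨m, hm, rfl⟩, ?_⟩
    rw [add_comm]
    exact congrArg Subtype.val hmb
  · refine lt_of_le_not_ge ?_ fun h ↦ hM.1 (eq_top_iff.mpr fun x _ ↦ ?_)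
    · rintro _ ⟨m, -, rfl⟩
      exact m.2
    · obtain ⟨m, hm, hmx⟩ := h x.2
      rwa [← Subtype.ext hmx]
end

section
/- Let L₁ and L₂ be finite-dimensional elementary Lie algebras over a field k. Then the direct sum Lie algebra L₁ × L₂ (with componentwise bracket) is elementary. -/
section Prod

variable (L₁ L₂ : Type*)

/-- The componentwise Lie ring structure on the product of two Lie rings. -/
instance prodLieRing [LieRing L₁] [LieRing L₂] : LieRing (L₁ × L₂) where
  bracket x y := (⁅x.1, y.1⁆, ⁅x.2, y.2⁆)
  add_lie x y z := by ext <;> simp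
  lie_add x y z := by ext <;> simp
  lie_self x := by ext <;> simp
  leibniz_lie x y z := by ext <;> simp

/-- The componentwise Lie algebra structure on the product of two Lie algebras. -/
instance prodLieAlgebra (k : Type*) [Field k] [LieRing L₁] [LieRing L₂]
    [LieAlgebra k L₁] [LieAlgebra k L₂] : LieAlgebra k (L₁ × L₂) where
  lie_smul t x y := by
    show (⁅x.1, (t • y).1⁆, ⁅x.2, (t • y).2⁆) = t • (⁅x.1, y.1⁆, ⁅x.2, y.2⁆)
    ext <;> simp

end Prod

/-- The preimage of a maximal subalgebra under a surjective Lie algebra homomorphism is maximal. -/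
theorem LieSubalgebra.isCoatom_comap_of_surjective {k L L' : Type*} [Field k]
    [LieRing L] [LieAlgebra k L] [LieRing L'] [LieAlgebra k L'] {f : L →ₗ⁅k⁆ L'}
    (hf : Function.Surjective f) {M : LieSubalgebra k L'} (hM : IsCoatom M) :
    IsCoatom (M.comap f) := by
  refine ⟨fun h ↦ hM.1 ?_, fun N hN ↦ ?_⟩
  · refine eq_top_iff.2 fun y _ ↦ ?_
    obtain ⟨x, rfl⟩ := hf y
    have hx : x ∈ M.comap f := h ▸ LieSubalgebra.mem_top x
    exact hx
  · obtain ⟨hle, x, hxN, hxM⟩ := SetLike.lt_iff_le_and_exists.1 hN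
    have hmap : N.map f = ⊤ := by
      refine hM.2 _ (SetLike.lt_iff_le_and_exists.2 ⟨fun y hy ↦ ?_, f x, ?_, hxM⟩)
      · obtain ⟨z, rfl⟩ := hf y
        exact (LieSubalgebra.mem_map _ _ _).2 ⟨z, hle hy, rfl⟩
      · exact (LieSubalgebra.mem_map _ _ _).2 ⟨x, hxN, rfl⟩
    refine eq_top_iff.2 fun y _ ↦ ?_
    have hy : f y ∈ N.map f := hmap ▸ LieSubalgebra.mem_top _
    obtain ⟨z, hz, hzy⟩ := (LieSubalgebra.mem_map _ _ _).1 hy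
    have hker : y - z ∈ M.comap f := by
      change f (y - z) ∈ M
      rw [map_sub, hzy, sub_self]
      exact M.zero_mem
    simpa using N.add_mem (hle hker) hz

/-- A surjective Lie algebra homomorphism maps the Frattini subalgebra into the Frattini
subalgebra. -/
theorem map_mem_lieFrattini_of_surjective {k L L' : Type*} [Field k]
    [LieRing L] [LieAlgebra k L] [LieRing L'] [LieAlgebra k L'] {f : L →ₗ⁅k⁆ L'}
    (hf : Function.Surjective f) {x : L} (hx : x ∈ lieFrattini k L) :
    f x ∈ lieFrattini k L' := by
  rw [lieFrattini, ← SetLike.mem_coe, LieSubalgebra.coe_sInf, Set.mem_iInter₂]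
  exact fun M hM ↦ (sInf_le (LieSubalgebra.isCoatom_comap_of_surjective hf hM) :
    lieFrattini k L ≤ M.comap f) hx

/-- A Lie algebra homomorphism into an elementary Lie algebra kills the Frattini subalgebra. -/
theorem IsElementaryLieAlgebra.map_eq_zero {k L L' : Type*} [Field k]
    [LieRing L] [LieAlgebra k L] [LieRing L'] [LieAlgebra k L']
    (h : IsElementaryLieAlgebra k L') (f : L →ₗ⁅k⁆ L') {x : L} (hx : x ∈ lieFrattini k L) :
    f x = 0 := by
  have hfx := map_mem_lieFrattini_of_surjective f.surjective_rangeRestrict hx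
  rw [h f.range, LieSubalgebra.mem_bot] at hfx
  exact congrArg Subtype.val hfx

/-- the direct sum (product) of two elementary Lie algebras is elementary. -/
theorem stmt14 (k L₁ L₂ : Type*) [Field k] [LieRing L₁] [LieAlgebra k L₁]
    [LieRing L₂] [LieAlgebra k L₂] [FiniteDimensional k L₁] [FiniteDimensional k L₂]
    (h₁ : IsElementaryLieAlgebra k L₁) (h₂ : IsElementaryLieAlgebra k L₂) :
    IsElementaryLieAlgebra k (L₁ × L₂) := by
  intro C
  refine eq_bot_iff.2 fun x hx ↦ (LieSubalgebra.mem_bot x).2 (Subtype.ext (Prod.ext ?_ ?_))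
  · exact h₁.map_eq_zero
      (({ LinearMap.fst k L₁ L₂ with map_lie' := rfl } : L₁ × L₂ →ₗ⁅k⁆ L₁).comp C.incl) hx
  · exact h₂.map_eq_zero
      (({ LinearMap.snd k L₁ L₂ with map_lie' := rfl } : L₁ × L₂ →ₗ⁅k⁆ L₂).comp C.incl) hx
end
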